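/- For every n>1, for K_n and M_n as in the defining conditions (Hyper section), every balanced KCTL* formula ψ with |ψ|<n, every observation map Obs, and every initial path π of K_n (equivalently M_n): (1) π,0⊨_{K_n,Obs}ψ iff π,0⊨_{M_n,Obs}ψ; (2) for all i∈[1,ℓ_n], π,i⊨_{K_n,Obs}ψ iff π,i⊨_{M_n,Obs}ψ; and (3) if π ≠ π(ξ_n) then for all i≥ℓ_n+1, π,i⊨_{K_n,Obs}ψ iff π,i⊨_{M_n,Obs}ψ. -/

import Mathlib

/-- A tree structure: a Kripke structure whose state set is a prefix-closed set of
words over ℕ, with root `[]` as initial state and edges only from a node `τ` to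
children `τ ++ [i]`. -/
structure TreeKripke (AP : Type) where
  nodes : Set (List ℕ)
  root_mem : ([] : List ℕ) ∈ nodes
  prefix_closed : ∀ ⦃τ τ' : List ℕ⦄, τ ∈ nodes → τ' <+: τ → τ' ∈ nodes
  edge : List ℕ → List ℕ → Prop
  edge_mem_l : ∀ ⦃τ τ' : List ℕ⦄, edge τ τ' → τ ∈ nodes
  edge_mem_r : ∀ ⦃τ τ' : List ℕ⦄, edge τ τ' → τ' ∈ nodes
  edge_child : ∀ ⦃τ τ' : List ℕ⦄, edge τ τ' → ∃ i, τ' = τ ++ [i]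
  total : ∀ τ ∈ nodes, ∃ τ', edge τ τ'
  V : List ℕ → Set AP

/-- `pa` is an initial path of the tree structure `T`. -/
def TreeKripke.TInit {AP : Type} (T : TreeKripke AP) (pa : ℕ → List ℕ) : Prop :=
  pa 0 = [] ∧ ∀ i, T.edge (pa i) (pa (i + 1))

/-- A Kripke structure whose states are natural numbers (used to define unwindings,
and hence regular tree structures). -/
structure NKripke (AP : Type) where
  states : Set ℕ
  s0 : ℕ
  s0_mem : s0 ∈ states
  E : ℕ → ℕ → Prop
  E_mem : ∀ ⦃s t⦄, E s t → s ∈ states ∧ t ∈ states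
  total : ∀ s ∈ states, ∃ t, E s t
  V : ℕ → Set AP

/-- A tree structure is regular if it is the unwinding of a finite Kripke structure:
its nodes are the finite paths from the initial state (coded by the lists of visited
states), all parent-child pairs are edges, and labels come from the labels of the
corresponding states. -/
def IsRegularTree {AP : Type} (T : TreeKripke AP) : Prop :=
  ∃ K : NKripke AP, K.states.Finite ∧
    T.nodes = {τ : List ℕ | List.Chain' K.E (K.s0 :: τ)} ∧
    (∀ τ τ', T.edge τ τ' ↔ (τ ∈ T.nodes ∧ τ' ∈ T.nodes ∧ ∃ i, τ' = τ ++ [i])) ∧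
    (∀ τ ∈ T.nodes, T.V τ = K.V ((K.s0 :: τ).getLast (List.cons_ne_nil _ _)))
/-- Syntax of KCTL* over atomic propositions `AP` and agents `Agt`. -/
inductive KCTLs (AP Agt : Type) where
  | tt : KCTLs AP Agt
  | atom : AP → KCTLs AP Agt
  | neg : KCTLs AP Agt → KCTLs AP Agt
  | disj : KCTLs AP Agt → KCTLs AP Agt → KCTLs AP Agt
  | next : KCTLs AP Agt → KCTLs AP Agt
  | untl : KCTLs AP Agt → KCTLs AP Agt → KCTLs AP Agt
  | ex : KCTLs AP Agt → KCTLs AP Agt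
  | know : Agt → KCTLs AP Agt → KCTLs AP Agt

/-- A KCTL* sentence: every temporal/knowledge modality is in the scope of a path
quantifier. -/
def KCTLs.isSentence {AP Agt : Type} : KCTLs AP Agt → Prop
  | .tt => True
  | .atom _ => True
  | .neg φ => φ.isSentence
  | .disj φ ψ => φ.isSentence ∧ ψ.isSentence
  | .next _ => False
  | .untl _ _ => False
  | .know _ _ => False
  | .ex _ => True

/-- No path quantifiers occur in the formula. -/
def KCTLs.quantFree {AP Agt : Type} : KCTLs AP Agt → Prop
  | .tt => True
  | .atom _ => True
  | .neg φ => φ.quantFree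
  | .disj φ ψ => φ.quantFree ∧ ψ.quantFree
  | .next φ => φ.quantFree
  | .untl φ ψ => φ.quantFree ∧ ψ.quantFree
  | .ex _ => False
  | .know _ φ => φ.quantFree

/-- A KLTL sentence: of the form `∀ φ = ¬∃¬φ` with `φ` free of path quantifiers. -/
def KCTLs.isKLTL {AP Agt : Type} : KCTLs AP Agt → Prop
  | .neg (.ex (.neg φ)) => φ.quantFree
  | _ => False

/-- Size of a KCTL* formula. -/
def KCTLs.size {AP Agt : Type} : KCTLs AP Agt → ℕ
  | .tt => 1
  | .atom _ => 1
  | .neg φ => φ.size + 1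
  | .disj φ ψ => φ.size + ψ.size + 1
  | .next φ => φ.size + 1
  | .untl φ ψ => φ.size + ψ.size + 1
  | .ex φ => φ.size + 1
  | .know _ φ => φ.size + 1

/-- A KCTL* formula is balanced if for every until subformula `φ U ψ`, `|φ| = |ψ|`. -/
def KCTLs.balanced {AP Agt : Type} : KCTLs AP Agt → Prop
  | .tt => True
  | .atom _ => True
  | .neg φ => φ.balanced
  | .disj φ ψ => φ.balanced ∧ ψ.balanced
  | .next φ => φ.balanced
  | .untl φ ψ => φ.size = ψ.size ∧ φ.balanced ∧ ψ.balanced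
  | .ex φ => φ.balanced
  | .know _ φ => φ.balanced
/-- Satisfaction of KCTL* over a tree structure `(T, Obs)` (paths are given as raw
sequences of nodes). -/
def KCTLs.satT {AP Agt : Type} (T : TreeKripke AP) (Obs : Agt → Set AP) :
    KCTLs AP Agt → (ℕ → List ℕ) → ℕ → Prop
  | .tt, _, _ => True
  | .atom p, pa, i => p ∈ T.V (pa i)
  | .neg φ, pa, i => ¬ KCTLs.satT T Obs φ pa i
  | .disj φ ψ, pa, i => KCTLs.satT T Obs φ pa i ∨ KCTLs.satT T Obs ψ pa i
  | .next φ, pa, i => KCTLs.satT T Obs φ pa (i + 1)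
  | .untl φ ψ, pa, i => ∃ j, i ≤ j ∧ KCTLs.satT T Obs ψ pa j ∧
      ∀ k, i ≤ k → k < j → KCTLs.satT T Obs φ pa k
  | .ex φ, pa, i => ∃ pa', T.TInit pa' ∧ (∀ j, j ≤ i → pa' j = pa j) ∧
      KCTLs.satT T Obs φ pa' i
  | .know a φ, pa, i => ∀ pa', T.TInit pa' →
      (∀ j, j ≤ i → ∀ q ∈ Obs a, (q ∈ T.V (pa j) ↔ q ∈ T.V (pa' j))) →
      KCTLs.satT T Obs φ pa' i

/-- `(T, Obs) ⊨ φ` for a tree structure `T`. -/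
def KCTLs.modelsT {AP Agt : Type} (T : TreeKripke AP) (Obs : Agt → Set AP)
    (φ : KCTLs AP Agt) : Prop :=
  ∃ pa, T.TInit pa ∧ KCTLs.satT T Obs φ pa 0
/-- The defining conditions of the regular tree structure `K_n` (Hyper section),
over `AP = {p}` (modelled by `Unit`), with parameter `ℓ = ℓ_n > 1`.
Words over `2^{p}` are modelled as lists of booleans. -/
structure HyperKnData (n : ℕ) (T : TreeKripke Unit) (ℓ : ℕ) where
  /-- the distinguished successor `η` of the root -/
  eta : List ℕ
  /-- the successors `ξ_1, …, ξ_{2n}` of the root -/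
  xi : ℕ → List ℕ
  /-- the words `w_0, …, w_{2n}` of length `ℓ` -/
  w : ℕ → List Bool
  /-- the unique initial path visiting `η` -/
  pEta : ℕ → List ℕ
  /-- the unique initial paths visiting `ξ_1, …, ξ_{2n}` -/
  pXi : ℕ → ℕ → List ℕ
  root_label : () ∈ T.V []
  edge_eta : T.edge [] eta
  edge_xi : ∀ k, 1 ≤ k → k ≤ 2 * n → T.edge [] (xi k)
  succ_only : ∀ τ, T.edge [] τ → τ = eta ∨ ∃ k, 1 ≤ k ∧ k ≤ 2 * n ∧ τ = xi k
  eta_ne_xi : ∀ k, 1 ≤ k → k ≤ 2 * n → eta ≠ xi k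
  xi_inj : ∀ k k', 1 ≤ k → k ≤ 2 * n → 1 ≤ k' → k' ≤ 2 * n → xi k = xi k' → k = k'
  pEta_init : T.TInit pEta
  pEta_visits : ∃ i, pEta i = eta
  pEta_unique : ∀ pa, T.TInit pa → (∃ i, pa i = eta) → pa = pEta
  pXi_init : ∀ k, 1 ≤ k → k ≤ 2 * n → T.TInit (pXi k)
  pXi_visits : ∀ k, 1 ≤ k → k ≤ 2 * n → ∃ i, pXi k i = xi k
  pXi_unique : ∀ k, 1 ≤ k → k ≤ 2 * n → ∀ pa, T.TInit pa → (∃ i, pa i = xi k) → pa = pXi k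
  w_len : ∀ k, k ≤ 2 * n → (w k).length = ℓ
  w_distinct : ∀ k k', k ≤ 2 * n → k' ≤ 2 * n → k ≠ k' → w k ≠ w k'
  w0_all : w 0 = List.replicate ℓ true
  wn_last : (w n).getD (ℓ - 1) false = false
  wn1_last : (w (n - 1)).getD (ℓ - 1) false = true
  /-- the trace of `π(η)` is `{p}·w_0·∅^n·{p}^n·{p}^ω` -/
  trace_eta₀ : () ∈ T.V (pEta 0)
  trace_eta₁ : ∀ i, 1 ≤ i → i ≤ ℓ → (() ∈ T.V (pEta i) ↔ (w 0).getD (i - 1) false = true)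
  trace_eta₂ : ∀ i, ℓ + 1 ≤ i → i ≤ ℓ + n → () ∉ T.V (pEta i)
  trace_eta₃ : ∀ i, ℓ + n + 1 ≤ i → () ∈ T.V (pEta i)
  /-- the trace of `π(ξ_k)` is `{p}·w_k·∅^{2n-k}·{p}^k·{p}^ω` -/
  trace_xi₀ : ∀ k, 1 ≤ k → k ≤ 2 * n → () ∈ T.V (pXi k 0)
  trace_xi₁ : ∀ k, 1 ≤ k → k ≤ 2 * n → ∀ i, 1 ≤ i → i ≤ ℓ →
      (() ∈ T.V (pXi k i) ↔ (w k).getD (i - 1) false = true)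
  trace_xi₂ : ∀ k, 1 ≤ k → k ≤ 2 * n → ∀ i, ℓ + 1 ≤ i → i ≤ ℓ + (2 * n - k) →
      () ∉ T.V (pXi k i)
  trace_xi₃ : ∀ k, 1 ≤ k → k ≤ 2 * n → ∀ i, ℓ + (2 * n - k) + 1 ≤ i →
      () ∈ T.V (pXi k i)

/-- `M` is obtained from `K_n` by replacing the label `{p}` of the node
`π(ξ_n)(ℓ+1+n)` with `∅`. -/
def MObtainedHyper {n ℓ : ℕ} {T : TreeKripke Unit} (M : TreeKripke Unit)
    (D : HyperKnData n T ℓ) : Prop :=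
  M.nodes = T.nodes ∧ M.edge = T.edge ∧
    ∀ τ, M.V τ = if τ = D.pXi n (ℓ + 1 + n) then ∅ else T.V τ

/-- Satisfaction of a KCTL* formula at a state `(m, R)`: the current path carries `m` more
positions labelled `∅` before turning to `{p}` forever, blind agents consider every `x ≤ R` possible
as the number of such positions, and agents observing `p` know the current path. -/
def tailSat {Agt : Type} (Obs : Agt → Set Unit) : KCTLs Unit Agt → ℕ → ℕ → Prop
  | .tt, _, _ => True
  | .atom _, m, _ => m = 0
  | .neg φ, m, R => ¬ tailSat Obs φ m R
  | .disj φ ψ, m, R => tailSat Obs φ m R ∨ tailSat Obs ψ m R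
  | .next φ, m, R => tailSat Obs φ (m - 1) (R - 1)
  | .untl φ ψ, m, R => ∃ j, tailSat Obs ψ (m - j) (R - j) ∧
      ∀ k, k < j → tailSat Obs φ (m - k) (R - k)
  | .ex φ, m, R => tailSat Obs φ m R
  | .know a φ, m, R => (() ∈ Obs a → tailSat Obs φ m R) ∧
      (() ∉ Obs a → ∀ x, x ≤ R → tailSat Obs φ x R)

/-- Indistinguishability of the states `(m, R)` and `(m', R')` by balanced formulas of
size at most `s`. -/
def TailEquiv (s m R m' R' : ℕ) : Prop :=
  m ≤ R ∧ m' ≤ R' ∧ (m = m' ∨ s ≤ m ∧ s ≤ m') ∧ (R = R' ∨ 2 * s ≤ R ∧ 2 * s ≤ R') ∧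
    (R + m' = R' + m ∨ s ≤ R - m + 1 ∧ s ≤ R' - m' + 1)

namespace TailEquiv

variable {s t m R m' R' : ℕ}

theorem symm (h : TailEquiv s m R m' R') : TailEquiv s m' R' m R := by
  unfold TailEquiv at *; omega

theorem mono (hst : t ≤ s) (h : TailEquiv s m R m' R') : TailEquiv t m R m' R' := by
  unfold TailEquiv at *; omega

theorem step (hs : 1 ≤ s) (h : TailEquiv (s + 1) m R m' R') :
    TailEquiv s (m - 1) (R - 1) (m' - 1) (R' - 1) := by
  unfold TailEquiv at *; omega

theorem exists_blind (h : TailEquiv (s + 1) m R m' R') {x : ℕ} (hx : x ≤ R) :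
    ∃ x', x' ≤ R' ∧ TailEquiv s x R x' R' := by
  unfold TailEquiv at *
  by_cases hR : R = R'
  · exact ⟨x, by omega, by omega⟩
  by_cases h1 : x < s
  · exact ⟨x, by omega, by omega⟩
  by_cases h2 : R - x < s
  · exact ⟨R' - (R - x), by omega, by omega⟩
  · exact ⟨s, by omega, by omega⟩

/-- Matching of the positions inspected by an until with arguments of size `t`. -/
theorem exists_until (ht : 1 ≤ t) (h : TailEquiv (2 * t + 1) m R m' R') (j : ℕ) :
    ∃ j', TailEquiv t (m - j) (R - j) (m' - j') (R' - j') ∧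
      ∀ k', k' < j' → ∃ k, k < j ∧ TailEquiv t (m - k) (R - k) (m' - k') (R' - k') := by
  unfold TailEquiv at *
  by_cases hm : m = m'
  · subst hm
    by_cases hR : R = R'
    · exact ⟨j, by omega, fun k' _ => ⟨k', by omega, by omega⟩⟩
    by_cases hj : j ≤ m
    · exact ⟨j, by omega, fun k' _ => ⟨k', by omega, by omega⟩⟩
    by_cases hr : R - j < 2 * t
    · refine ⟨R' - (R - j), by omega, fun k' hk' => ?_⟩
      by_cases h1 : k' ≤ m
      · exact ⟨k', by omega, by omega⟩
      by_cases h2 : R' - k' ≤ R - m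
      · exact ⟨R - (R' - k'), by omega, by omega⟩
      · exact ⟨m, by omega, by omega⟩
    · exact ⟨m, by omega, fun k' _ => ⟨k', by omega, by omega⟩⟩
  · by_cases hj : j ≤ m
    · by_cases hx : m - j < 2 * t
      · refine ⟨m' - (m - j), by omega, fun k' hk' => ?_⟩
        by_cases h1 : m' - k' ≤ m
        · exact ⟨m - (m' - k'), by omega, by omega⟩
        · exact ⟨0, by omega, by omega⟩
      · exact ⟨0, by omega, fun k' hk' => absurd hk' (by omega)⟩
    · have before : ∀ k', k' < m' → ∃ k, k < j ∧ k ≤ m ∧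
          (m - k = m' - k' ∨ k = 0 ∧ m < m' - k') := fun k' _ => by
        by_cases h1 : m' - k' ≤ m
        · exact ⟨m - (m' - k'), by omega, by omega, by omega⟩
        · exact ⟨0, by omega, by omega, by omega⟩
      by_cases hg : R + m' = R' + m
      · refine ⟨m' + (j - m), by omega, fun k' hk' => ?_⟩
        by_cases h1 : k' < m'
        · obtain ⟨k, hk, hkm, hk2⟩ := before k' h1
          exact ⟨k, hk, by omega⟩
        · exact ⟨m + (k' - m'), by omega, by omega⟩
      · by_cases hr : R - j < 2 * t
        · refine ⟨R' - (R - j), by omega, fun k' hk' => ?_⟩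
          by_cases h1 : k' < m'
          · obtain ⟨k, hk, hkm, hk2⟩ := before k' h1
            exact ⟨k, hk, by omega⟩
          by_cases h2 : R' - k' ≤ R - m
          · exact ⟨R - (R' - k'), by omega, by omega⟩
          · exact ⟨m, by omega, by omega⟩
        · refine ⟨m', by omega, fun k' hk' => ?_⟩
          obtain ⟨k, hk, hkm, hk2⟩ := before k' hk'
          exact ⟨k, hk, by omega⟩

end TailEquiv

theorem KCTLs.one_le_size {AP Agt : Type} (φ : KCTLs AP Agt) : 1 ≤ φ.size := by
  cases φ <;> simp [KCTLs.size]

/-- Balanced formulas of size at most `s` do not distinguish `s`-equivalent states. -/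
theorem tailSat_iff_of_tailEquiv {Agt : Type} (Obs : Agt → Set Unit) (ψ : KCTLs Unit Agt) :
    ψ.balanced → ∀ m R m' R', TailEquiv ψ.size m R m' R' →
      (tailSat Obs ψ m R ↔ tailSat Obs ψ m' R') := by
  induction ψ with
  | tt => intros; rfl
  | atom p =>
    intro _ m R m' R' h
    simp only [tailSat]
    simp only [TailEquiv, KCTLs.size] at h
    omega
  | neg φ ih =>
    intro hb m R m' R' h
    exact not_congr (ih hb m R m' R' (h.mono (Nat.le_succ _)))
  | disj φ ψ ih₁ ih₂ =>
    intro hb m R m' R' h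
    refine or_congr (ih₁ hb.1 m R m' R' (h.mono ?_)) (ih₂ hb.2 m R m' R' (h.mono ?_)) <;>
      simp only [KCTLs.size] <;> omega
  | next φ ih =>
    intro hb m R m' R' h
    exact ih hb _ _ _ _ (TailEquiv.step φ.one_le_size h)
  | untl φ ψ ih₁ ih₂ =>
    intro hb m R m' R' h
    obtain ⟨hs, hb₁, hb₂⟩ := hb
    have key : ∀ m R m' R', TailEquiv (KCTLs.untl φ ψ).size m R m' R' →
        tailSat Obs (.untl φ ψ) m R → tailSat Obs (.untl φ ψ) m' R' := by
      rintro m R m' R' h ⟨j, hj, hlt⟩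
      have h' : TailEquiv (2 * ψ.size + 1) m R m' R' := by
        refine h.mono ?_
        simp only [KCTLs.size]; omega
      obtain ⟨j', hj', hlt'⟩ := TailEquiv.exists_until ψ.one_le_size h' j
      refine ⟨j', (ih₂ hb₂ _ _ _ _ hj').1 hj, fun k' hk' => ?_⟩
      obtain ⟨k, hk, hkk'⟩ := hlt' k' hk'
      exact (ih₁ hb₁ _ _ _ _ (hs ▸ hkk')).1 (hlt k hk)
    exact ⟨key _ _ _ _ h, key _ _ _ _ h.symm⟩
  | ex φ ih =>
    intro hb m R m' R' h
    exact ih hb m R m' R' (h.mono (Nat.le_succ _))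
  | know a φ ih =>
    intro hb m R m' R' h
    have key : ∀ m R m' R', TailEquiv (φ.size + 1) m R m' R' →
        tailSat Obs (.know a φ) m R → tailSat Obs (.know a φ) m' R' := by
      rintro m R m' R' h ⟨h1, h2⟩
      refine ⟨fun ha => (ih hb _ _ _ _ (h.mono (Nat.le_succ _))).1 (h1 ha), fun ha x hx => ?_⟩
      obtain ⟨y, hy, hxy⟩ := h.symm.exists_blind hx
      exact (ih hb _ _ _ _ hxy).2 (h2 ha y hy)
    exact ⟨key _ _ _ _ h, key _ _ _ _ h.symm⟩

/-- If the initial paths of `S` are separated by their traces up to position `ℓ` and continue with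
`tl k ≤ N` positions labelled `∅` followed by `{p}` forever, where `tl` takes all values up to `N`,
then satisfaction after position `ℓ` is given by `tailSat`. -/
theorem KCTLs.satT_iff_tailSat {Agt : Type} (S : TreeKripke Unit) (Obs : Agt → Set Unit)
    {I ℓ N : ℕ} {path : ℕ → ℕ → List ℕ} {tl : ℕ → ℕ}
    (hinit : ∀ pa, S.TInit pa ↔ ∃ k, k ≤ I ∧ pa = path k)
    (hsep : ∀ k k', k ≤ I → k' ≤ I →
      (∀ i, i ≤ ℓ → (() ∈ S.V (path k i) ↔ () ∈ S.V (path k' i))) → k = k')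
    (htail : ∀ k, k ≤ I → ∀ j, () ∈ S.V (path k (ℓ + 1 + j)) ↔ tl k ≤ j)
    (hle : ∀ k, k ≤ I → tl k ≤ N) (hsurj : ∀ x, x ≤ N → ∃ k, k ≤ I ∧ tl k = x)
    (ψ : KCTLs Unit Agt) :
    ∀ k, k ≤ I → ∀ j,
      (KCTLs.satT S Obs ψ (path k) (ℓ + 1 + j) ↔ tailSat Obs ψ (tl k - j) (N - j)) := by
  induction ψ with
  | tt => intros; rfl
  | atom p =>
    intro k hk j
    refine (htail k hk j).trans ?_
    simp only [tailSat]; omega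
  | neg φ ih => exact fun k hk j => not_congr (ih k hk j)
  | disj φ ψ ih₁ ih₂ => exact fun k hk j => or_congr (ih₁ k hk j) (ih₂ k hk j)
  | next φ ih =>
    intro k hk j
    simp only [KCTLs.satT, tailSat, Nat.sub_sub]
    exact ih k hk (j + 1)
  | untl φ ψ ih₁ ih₂ =>
    intro k hk j
    simp only [KCTLs.satT, tailSat, Nat.sub_sub]
    constructor
    · rintro ⟨i, hi, hψ, hφ⟩
      obtain ⟨d, rfl⟩ := Nat.exists_eq_add_of_le hi
      rw [add_assoc] at hψ
      refine ⟨d, (ih₂ k hk (j + d)).1 hψ, fun e he => (ih₁ k hk (j + e)).1 ?_⟩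
      exact hφ (ℓ + 1 + (j + e)) (by omega) (by omega)
    · rintro ⟨d, hψ, hφ⟩
      refine ⟨ℓ + 1 + (j + d), by omega, (ih₂ k hk _).2 hψ, fun i hi hi' => ?_⟩
      obtain ⟨e, rfl⟩ := Nat.exists_eq_add_of_le hi
      rw [add_assoc]
      exact (ih₁ k hk (j + e)).2 (hφ e (by omega))
  | ex φ ih =>
    intro k hk j
    refine Iff.trans ⟨?_, fun h => ⟨path k, (hinit _).2 ⟨k, hk, rfl⟩, fun _ _ => rfl, h⟩⟩ (ih k hk j)
    rintro ⟨pa, hpa, heq, h⟩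
    obtain ⟨k', hk', rfl⟩ := (hinit pa).1 hpa
    have : k' = k := hsep k' k hk' hk fun i hi => by rw [heq i (by omega)]
    exact this ▸ h
  | know a φ ih =>
    intro k hk j
    by_cases ha : () ∈ Obs a
    · refine Iff.trans ⟨fun h => h (path k) ((hinit _).2 ⟨k, hk, rfl⟩) fun _ _ _ _ => Iff.rfl, ?_⟩
        ((ih k hk j).trans ⟨fun h => ⟨fun _ => h, fun h' => absurd ha h'⟩, fun h => h.1 ha⟩)
      intro h pa hpa heq
      obtain ⟨k', hk', rfl⟩ := (hinit pa).1 hpa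
      have : k = k' := hsep k k' hk hk' fun i hi => heq i (by omega) () ha
      exact this ▸ h
    · refine Iff.trans (b := ∀ k', k' ≤ I → KCTLs.satT S Obs φ (path k') (ℓ + 1 + j)) ?_ ?_
      · constructor
        · intro h k' hk'
          exact h _ ((hinit _).2 ⟨k', hk', rfl⟩) fun _ _ _ hq => absurd hq ha
        · intro h pa hpa _
          obtain ⟨k', hk', rfl⟩ := (hinit pa).1 hpa
          exact h k' hk'
      · constructor
        · refine fun h => ⟨fun h' => absurd h' ha, fun _ x hx => ?_⟩
          obtain ⟨k', hk', hx'⟩ := hsurj (min (x + j) N) (min_le_right _ _)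
          have hx'' : x = tl k' - j := by omega
          exact hx'' ▸ (ih k' hk' j).1 (h k' hk')
        · intro h k' hk'
          exact (ih k' hk' j).2 (h.2 ha _ (Nat.sub_le_sub_right (hle k' hk') j))

namespace TreeKripke

variable {AP : Type} {T : TreeKripke AP} {pa pb : ℕ → List ℕ}

theorem TInit.length_eq (h : T.TInit pa) (i : ℕ) : (pa i).length = i := by
  induction i with
  | zero => simp [h.1]
  | succ i ih =>
    obtain ⟨a, ha⟩ := T.edge_child (h.2 i)
    simp [ha, ih]

theorem TInit.eq_of_le (ha : T.TInit pa) (hb : T.TInit pb) {i : ℕ} (h : pa i = pb i) :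
    ∀ j, j ≤ i → pa j = pb j := by
  induction i with
  | zero =>
    intro j hj
    obtain rfl := Nat.le_zero.1 hj
    exact h
  | succ i ih =>
    intro j hj
    obtain ⟨a, ha'⟩ := T.edge_child (ha.2 i)
    obtain ⟨b, hb'⟩ := T.edge_child (hb.2 i)
    have hi : pa i = pb i := by
      rw [ha', hb'] at h
      exact (List.append_inj' h rfl).1
    rcases Nat.lt_or_ge i j with h1 | h1
    · obtain rfl : j = i + 1 := by omega
      exact h
    · exact ih hi j h1

end TreeKripke

namespace HyperKnData

variable {n ℓ : ℕ} {T : TreeKripke Unit} (D : HyperKnData n T ℓ)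

/-- The initial paths: `π(η)` for index `0`, and `π(ξ_k)` for `k ≥ 1`. -/
def path (k : ℕ) : ℕ → List ℕ := if k = 0 then D.pEta else D.pXi k

/-- The number of positions labelled `∅` right after position `ℓ`. -/
def tailLen (n k : ℕ) : ℕ := if k = 0 then n else 2 * n - k

theorem init_iff (pa : ℕ → List ℕ) : T.TInit pa ↔ ∃ k, k ≤ 2 * n ∧ pa = D.path k := by
  constructor
  · intro h
    have h1 : T.edge [] (pa 1) := h.1 ▸ h.2 0
    rcases D.succ_only _ h1 with h2 | ⟨k, hk, hk', h2⟩
    · exact ⟨0, by omega, D.pEta_unique pa h ⟨1, h2⟩⟩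
    · refine ⟨k, hk', ?_⟩
      rw [path, if_neg (by omega)]
      exact D.pXi_unique k hk hk' pa h ⟨1, h2⟩
  · rintro ⟨k, hk, rfl⟩
    unfold path
    split_ifs with h
    · exact D.pEta_init
    · exact D.pXi_init k (by omega) hk

theorem trace_word {k : ℕ} (hk : k ≤ 2 * n) {i : ℕ} (hi : 1 ≤ i) (hi' : i ≤ ℓ) :
    () ∈ T.V (D.path k i) ↔ (D.w k).getD (i - 1) false = true := by
  unfold path
  split_ifs with h
  · subst h
    exact D.trace_eta₁ i hi hi'
  · exact D.trace_xi₁ k (by omega) hk i hi hi'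

theorem trace_tail {k : ℕ} (hk : k ≤ 2 * n) (j : ℕ) :
    () ∈ T.V (D.path k (ℓ + 1 + j)) ↔ tailLen n k ≤ j := by
  unfold path tailLen
  split_ifs with h
  · rcases Nat.lt_or_ge j n with hj | hj
    · exact iff_of_false (D.trace_eta₂ _ (by omega) (by omega)) (by omega)
    · exact iff_of_true (D.trace_eta₃ _ (by omega)) hj
  · rcases Nat.lt_or_ge j (2 * n - k) with hj | hj
    · exact iff_of_false (D.trace_xi₂ k (by omega) hk _ (by omega) (by omega)) (by omega)
    · exact iff_of_true (D.trace_xi₃ k (by omega) hk _ (by omega)) hj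

theorem eq_of_trace {k k' : ℕ} (hk : k ≤ 2 * n) (hk' : k' ≤ 2 * n)
    (h : ∀ i, i ≤ ℓ → (() ∈ T.V (D.path k i) ↔ () ∈ T.V (D.path k' i))) : k = k' := by
  by_contra hne
  refine D.w_distinct k k' hk hk' hne ?_
  refine List.ext_getElem (by rw [D.w_len k hk, D.w_len k' hk']) fun i hi hi' => ?_
  have hl : i < ℓ := D.w_len k hk ▸ hi
  have := h (i + 1) hl
  rw [D.trace_word hk (by omega) hl, D.trace_word hk' (by omega) hl] at this
  simpa [List.getD_eq_getElem, hi, hi'] using this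

variable {M : TreeKripke Unit}

theorem init_iff_of_obtained (hM : MObtainedHyper M D) (pa : ℕ → List ℕ) :
    M.TInit pa ↔ T.TInit pa := by
  simp only [TreeKripke.TInit, hM.2.1]

theorem mem_V_of_obtained (hn : 1 < n) (hM : MObtainedHyper M D) {k : ℕ} (hk : k ≤ 2 * n)
    (i : ℕ) : () ∈ M.V (D.path k i) ↔ () ∈ T.V (D.path k i) ∧ ¬ (k = n ∧ i = ℓ + 1 + n) := by
  have hpn : D.path n = D.pXi n := by rw [path, if_neg (by omega)]
  rw [hM.2.2]
  split_ifs with h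
  · rw [← hpn] at h
    have hki := (D.init_iff _).2 ⟨k, hk, rfl⟩
    have hni := (D.init_iff _).2 ⟨n, by omega, rfl⟩
    have hi : i = ℓ + 1 + n := by rw [← hki.length_eq i, h, hni.length_eq]
    subst hi
    have : k = n := D.eq_of_trace hk (by omega) fun j hj => by
      rw [hki.eq_of_le hni h j (by omega)]
    simp [this]
  · refine ⟨fun h' => ⟨h', ?_⟩, fun h' => h'.1⟩
    rintro ⟨rfl, rfl⟩
    exact h (by rw [hpn])

theorem satT_tail {Agt : Type} (hn : 1 < n) (Obs : Agt → Set Unit) (ψ : KCTLs Unit Agt) {k : ℕ}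
    (hk : k ≤ 2 * n) (j : ℕ) : KCTLs.satT T Obs ψ (D.path k) (ℓ + 1 + j) ↔
      tailSat Obs ψ (tailLen n k - j) (2 * n - 1 - j) := by
  refine KCTLs.satT_iff_tailSat T Obs (I := 2 * n) D.init_iff (fun k k' => D.eq_of_trace)
    (fun k hk j => D.trace_tail hk j) ?_ ?_ ψ k hk j
  · intro k hk
    unfold tailLen
    split_ifs <;> omega
  · intro x hx
    refine ⟨2 * n - x, by omega, ?_⟩
    rw [tailLen, if_neg (by omega)]
    omega

theorem satT_tail_of_obtained {Agt : Type} (hn : 1 < n) (hM : MObtainedHyper M D)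
    (Obs : Agt → Set Unit) (ψ : KCTLs Unit Agt) {k : ℕ} (hk : k ≤ 2 * n) (j : ℕ) :
    KCTLs.satT M Obs ψ (D.path k) (ℓ + 1 + j) ↔
      tailSat Obs ψ ((if k = n then n + 1 else tailLen n k) - j) (2 * n - 1 - j) := by
  refine KCTLs.satT_iff_tailSat M Obs (I := 2 * n)
    (tl := fun k => if k = n then n + 1 else tailLen n k)
    (fun pa => (D.init_iff_of_obtained hM pa).trans (D.init_iff pa)) ?_ ?_ ?_ ?_ ψ k hk j
  · intro k k' hk hk' h
    refine D.eq_of_trace hk hk' fun i hi => ?_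
    have := h i hi
    rw [D.mem_V_of_obtained hn hM hk, D.mem_V_of_obtained hn hM hk'] at this
    have hi' : i ≠ ℓ + 1 + n := by omega
    simpa [hi'] using this
  · intro k hk j
    rw [D.mem_V_of_obtained hn hM hk, D.trace_tail hk]
    unfold tailLen
    split_ifs <;> omega
  · intro k hk
    simp only [tailLen]
    split_ifs <;> omega
  · intro x hx
    by_cases h : x = n
    · exact ⟨0, by omega, by rw [if_neg (by omega), tailLen, if_pos rfl, h]⟩
    · refine ⟨2 * n - x, by omega, ?_⟩
      rw [if_neg (by omega), tailLen, if_neg (by omega)]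
      omega

theorem satT_succ_iff {Agt : Type} (hn : 1 < n) (hM : MObtainedHyper M D)
    (Obs : Agt → Set Unit) (ψ : KCTLs Unit Agt) (hb : ψ.balanced) (hs : ψ.size < n)
    {pa : ℕ → List ℕ} (hpa : T.TInit pa) :
    KCTLs.satT T Obs ψ pa (ℓ + 1) ↔ KCTLs.satT M Obs ψ pa (ℓ + 1) := by
  obtain ⟨k, hk, rfl⟩ := (D.init_iff pa).1 hpa
  refine (D.satT_tail hn Obs ψ hk 0).trans
    (Iff.trans ?_ (D.satT_tail_of_obtained hn hM Obs ψ hk 0).symm)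
  refine tailSat_iff_of_tailEquiv Obs ψ hb _ _ _ _ ?_
  simp only [TailEquiv, tailLen]
  split_ifs <;> omega

end HyperKnData

/-- An until transfers along predicates that agree up to `ℓ` if it transfers at `ℓ + 1`. -/
theorem until_transfer {P P' Q Q' : ℕ → Prop} {ℓ i : ℕ} (hi : i ≤ ℓ)
    (hP : ∀ k, k ≤ ℓ → P k → P' k) (hQ : ∀ k, k ≤ ℓ → Q k → Q' k)
    (h : (∃ j, ℓ + 1 ≤ j ∧ Q j ∧ ∀ k, ℓ + 1 ≤ k → k < j → P k) →
      ∃ j, ℓ + 1 ≤ j ∧ Q' j ∧ ∀ k, ℓ + 1 ≤ k → k < j → P' k) :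
    (∃ j, i ≤ j ∧ Q j ∧ ∀ k, i ≤ k → k < j → P k) →
      ∃ j, i ≤ j ∧ Q' j ∧ ∀ k, i ≤ k → k < j → P' k := by
  rintro ⟨j, hj, hQj, hPj⟩
  by_cases hjl : j ≤ ℓ
  · exact ⟨j, hj, hQ j hjl hQj, fun k hk hk' => hP k (by omega) (hPj k hk hk')⟩
  · obtain ⟨j', hj', hQ', hP'⟩ := h ⟨j, by omega, hQj, fun k hk hk' => hPj k (by omega) hk'⟩
    refine ⟨j', by omega, hQ', fun k hk hk' => ?_⟩
    by_cases hkl : k ≤ ℓ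
    · exact hP k hkl (hPj k hk (by omega))
    · exact hP' k (by omega) hk'

theorem HyperKnData.satT_iff_of_le {Agt : Type} {n ℓ : ℕ} {T M : TreeKripke Unit}
    (D : HyperKnData n T ℓ) (hn : 1 < n) (hM : MObtainedHyper M D) (Obs : Agt → Set Unit)
    (ψ : KCTLs Unit Agt) : ψ.balanced → ψ.size < n → ∀ pa, T.TInit pa → ∀ i, i ≤ ℓ →
      (KCTLs.satT T Obs ψ pa i ↔ KCTLs.satT M Obs ψ pa i) := by
  have hV : ∀ pa, T.TInit pa → ∀ i, i ≤ ℓ → ∀ q, q ∈ M.V (pa i) ↔ q ∈ T.V (pa i) := by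
    rintro pa hpa i hi ⟨⟩
    obtain ⟨k, hk, rfl⟩ := (D.init_iff pa).1 hpa
    rw [D.mem_V_of_obtained hn hM hk]
    exact and_iff_left (by omega)
  induction ψ with
  | tt => intros; rfl
  | atom p => exact fun _ _ pa hpa i hi => (hV pa hpa i hi p).symm
  | neg φ ih =>
    intro hb hs pa hpa i hi
    exact not_congr (ih hb (Nat.lt_of_succ_lt hs) pa hpa i hi)
  | disj φ ψ ih₁ ih₂ =>
    intro hb hs pa hpa i hi
    simp only [KCTLs.size] at hs
    exact or_congr (ih₁ hb.1 (by omega) pa hpa i hi) (ih₂ hb.2 (by omega) pa hpa i hi)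
  | next φ ih =>
    intro hb hs pa hpa i hi
    have hs' : φ.size < n := Nat.lt_of_succ_lt hs
    rcases Nat.lt_or_eq_of_le hi with h | rfl
    · exact ih hb hs' pa hpa (i + 1) h
    · exact D.satT_succ_iff hn hM Obs φ hb hs' hpa
  | untl φ ψ ih₁ ih₂ =>
    intro hb hs pa hpa i hi
    have hU := D.satT_succ_iff hn hM Obs (.untl φ ψ) hb hs hpa
    simp only [KCTLs.size] at hs
    have h₁ := ih₁ hb.2.1 (by omega) pa hpa
    have h₂ := ih₂ hb.2.2 (by omega) pa hpa
    exact ⟨until_transfer hi (fun k hk => (h₁ k hk).1) (fun k hk => (h₂ k hk).1) hU.1,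
      until_transfer hi (fun k hk => (h₁ k hk).2) (fun k hk => (h₂ k hk).2) hU.2⟩
  | ex φ ih =>
    intro hb hs pa _ i hi
    refine exists_congr fun pa' => ?_
    rw [D.init_iff_of_obtained hM]
    exact and_congr_right fun hpa' =>
      and_congr_right fun _ => ih hb (Nat.lt_of_succ_lt hs) pa' hpa' i hi
  | know a φ ih =>
    intro hb hs pa hpa i hi
    refine forall_congr' fun pa' => ?_
    rw [D.init_iff_of_obtained hM]
    refine forall_congr' fun hpa' => imp_congr ?_ (ih hb (Nat.lt_of_succ_lt hs) pa' hpa' i hi)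
    refine forall_congr' fun j => forall_congr' fun hj => forall_congr' fun q =>
      forall_congr' fun _ => ?_
    rw [hV pa hpa j (by omega), hV pa' hpa' j (by omega)]

/-- **Pathwise indistinguishability of `K_n` and `M_n` by small balanced KCTL\*
formulas** (Hyper section): for every `n > 1`, balanced KCTL* formula `ψ` with
`|ψ| < n`, observation map `Obs`, and initial path `π`:
(1) at position 0, `K_n` and `M_n` agree on `ψ`;
(2) at every position `i ∈ [1, ℓ_n]`, they agree on `ψ`;
(3) if `π ≠ π(ξ_n)`, they agree on `ψ` at every position `i ≥ ℓ_n + 1`. -/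
theorem Kn_Mn_pathwise_indistinguishable (Agt : Type) :
    ∀ n : ℕ, 1 < n → ∀ T : TreeKripke Unit, IsRegularTree T →
      ∀ ℓ : ℕ, 1 < ℓ → ∀ D : HyperKnData n T ℓ,
        ∀ M : TreeKripke Unit, MObtainedHyper M D →
          ∀ ψ : KCTLs Unit Agt, KCTLs.balanced ψ → KCTLs.size ψ < n →
            ∀ Obs : Agt → Set Unit, ∀ pa : ℕ → List ℕ, T.TInit pa →
              ((KCTLs.satT T Obs ψ pa 0 ↔ KCTLs.satT M Obs ψ pa 0) ∧
               (∀ i, 1 ≤ i → i ≤ ℓ →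
                  (KCTLs.satT T Obs ψ pa i ↔ KCTLs.satT M Obs ψ pa i)) ∧
               (pa ≠ D.pXi n → ∀ i, ℓ + 1 ≤ i →
                  (KCTLs.satT T Obs ψ pa i ↔ KCTLs.satT M Obs ψ pa i))) := by
  intro n hn T _ ℓ _ D M hM ψ hb hs Obs pa hpa
  have hle := D.satT_iff_of_le hn hM Obs ψ hb hs pa hpa
  refine ⟨hle 0 (Nat.zero_le _), fun i _ hi => hle i hi, fun hne i hi => ?_⟩
  obtain ⟨k, hk, rfl⟩ := (D.init_iff pa).1 hpa
  obtain ⟨j, rfl⟩ := Nat.exists_eq_add_of_le hi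
  have hkn : k ≠ n := by
    rintro rfl
    exact hne (by rw [HyperKnData.path, if_neg (by omega)])
  rw [D.satT_tail hn Obs ψ hk, D.satT_tail_of_obtained hn hM Obs ψ hk, if_neg hkn]
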